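/- Let D be a dissipation distance density and define R(F,Ḟ) := (1/4)∂²_{F₁²}D²(F,F)[Ḟ,Ḟ]. Then there exists an SO(3)-invariant open neighborhood U of SO(3) contained in GL₊(3) (i.e., QF ∈ U whenever F ∈ U and Q ∈ SO(3)) such that R satisfies the time-dependent frame indifference: R(F,Ḟ) = R(QF, Q(Ḟ + AF)) for all F ∈ U, all Ḟ ∈ ℝ^{3×3}, all Q ∈ SO(3), and all skew A ∈ ℝ^{3×3}. -/

import Mathlib

open Matrix Filter Topology

noncomputable section

attribute [local instance] Matrix.normedAddCommGroup Matrix.normedSpace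

/-- Real `3 × 3` matrices. -/
abbrev Mat3 := Matrix (Fin 3) (Fin 3) ℝ

/-- Squared Frobenius norm. -/
def frobSq (A : Mat3) : ℝ := ∑ i, ∑ j, (A i j) ^ 2

/-- Frobenius norm. -/
def frobNorm (A : Mat3) : ℝ := Real.sqrt (frobSq A)

/-- Symmetric part of a matrix. -/
def symPart (A : Mat3) : Mat3 := (2 : ℝ)⁻¹ • (A + Aᵀ)

/-- Matrices with positive determinant. -/
def GLp : Set Mat3 := {F | 0 < F.det}

/-- The special orthogonal group `SO(3)`. -/
def SO3 : Set Mat3 := {Q | Qᵀ * Q = 1 ∧ Q.det = 1}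

/-- The second Fréchet derivative of `F ↦ D(F, F₂)²` at `F₁`, applied to `(G, H)`. -/
def D2bil (D : Mat3 → Mat3 → ℝ) (F₁ F₂ G H : Mat3) : ℝ :=
  iteratedFDeriv ℝ 2 (fun F => (D F F₂) ^ 2) F₁ ![G, H]

/-- A dissipation distance density `D : GL₊(3) × GL₊(3) → [0,∞)`, satisfying
conditions (i)–(vi). -/
structure IsDissipationDensity (D : Mat3 → Mat3 → ℝ) : Prop where
  nonneg : ∀ F₁ ∈ GLp, ∀ F₂ ∈ GLp, 0 ≤ D F₁ F₂
  eq_zero : ∀ F₁ ∈ GLp, ∀ F₂ ∈ GLp, F₁ᵀ * F₁ = F₂ᵀ * F₂ → D F₁ F₂ = 0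
  pos_of_ne : ∀ F₁ ∈ GLp, ∀ F₂ ∈ GLp, F₁ᵀ * F₁ ≠ F₂ᵀ * F₂ → 0 < D F₁ F₂
  symm : ∀ F₁ ∈ GLp, ∀ F₂ ∈ GLp, D F₁ F₂ = D F₂ F₁
  triangle : ∀ F₁ ∈ GLp, ∀ F₂ ∈ GLp, ∀ F₃ ∈ GLp, D F₁ F₃ ≤ D F₁ F₂ + D F₂ F₃
  smooth : ∃ V : Set (Mat3 × Mat3), IsOpen V ∧ SO3 ×ˢ SO3 ⊆ V ∧ V ⊆ GLp ×ˢ GLp ∧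
    ContDiffOn ℝ 3 (fun p : Mat3 × Mat3 => (D p.1 p.2) ^ 2) V
  frame_indiff : ∀ Q₁ ∈ SO3, ∀ Q₂ ∈ SO3, ∀ F₁ ∈ GLp, ∀ F₂ ∈ GLp,
    D (Q₁ * F₁) (Q₂ * F₂) = D F₁ F₂
  coercive : ∃ c > (0 : ℝ), ∀ G : Mat3, c * frobSq (symPart G) ≤ D2bil D 1 1 G G

/-- The viscous dissipation potential `R(F,Ḟ) := (1/4)·∂²_{F₁²}D²(F,F)[Ḟ,Ḟ]`. -/
def Rpot (D : Mat3 → Mat3 → ℝ) (F Fdot : Mat3) : ℝ := (1 / 4 : ℝ) * D2bil D F F Fdot Fdot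

theorem hess_equiv {E : Type*} [NormedAddCommGroup E] [NormedSpace ℝ E] (g : E ≃L[ℝ] E)
    {f f' : E → ℝ} {x : E} (e : f =ᶠ[𝓝 x] f' ∘ g) (G H : E) :
    iteratedFDeriv ℝ 2 f' (g x) ![g G, g H] = iteratedFDeriv ℝ 2 f x ![G, H] := by
  rw [(e.iteratedFDeriv ℝ 2).eq_of_nhds]
  have h := g.iteratedFDerivWithin_comp_right f' uniqueDiffOn_univ (x := x) (Set.mem_univ _) 2
  rw [Set.preimage_univ, iteratedFDerivWithin_univ, iteratedFDerivWithin_univ] at h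
  rw [h, ContinuousMultilinearMap.compContinuousLinearMap_apply]
  congr 1
  ext i : 1
  fin_cases i <;> rfl

theorem hess_curve {E : Type*} [NormedAddCommGroup E] [NormedSpace ℝ E]
    {f : E → ℝ} {γ : ℝ → E} {v : E} (hγ : HasDerivAt γ v 0) (hs : ContDiffAt ℝ 3 f (γ 0))
    (hzero : ∀ t, fderiv ℝ f (γ t) = 0) (G : E) :
    iteratedFDeriv ℝ 2 f (γ 0) ![G + v, G + v] = iteratedFDeriv ℝ 2 f (γ 0) ![G, G] := by
  have hsym : IsSymmSndFDerivAt ℝ f (γ 0) := hs.isSymmSndFDerivAt (by simp; norm_num)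
  have hd : DifferentiableAt ℝ (fderiv ℝ f) (γ 0) :=
    (hs.fderiv_right (m := 1) (by norm_num)).differentiableAt (by norm_num)
  have hc := hd.hasFDerivAt.comp_hasDerivAt (0:ℝ) hγ
  have hc2 : HasDerivAt (fderiv ℝ f ∘ γ) 0 0 := by
    have : (fderiv ℝ f ∘ γ) = fun _ => 0 := by
      ext1 t; exact hzero t
    rw [this]; exact hasDerivAt_const _ _
  have hB : fderiv ℝ (fderiv ℝ f) (γ 0) v = 0 := hc.unique hc2
  rw [iteratedFDeriv_two_apply, iteratedFDeriv_two_apply]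
  change fderiv ℝ (fderiv ℝ f) (γ 0) (G + v) (G + v) = fderiv ℝ (fderiv ℝ f) (γ 0) G G
  rw [map_add, hsym.eq (G + v) v, hB, hsym.eq (G + v) G, map_add, hsym.eq G v, hB]
  simp

theorem exp_curve (A : Mat3) : HasDerivAt (fun t : ℝ => NormedSpace.exp (t • A)) A 0 := by
  have h := @hasDerivAt_exp_smul_const ℝ Mat3 _ Matrix.linftyOpNormedRing
    Matrix.linftyOpNormedAlgebra _ A 0
  rw [zero_smul, NormedSpace.exp_zero, one_mul] at h
  exact h

theorem exp_mem_SO3 (A : Mat3) (hA : Aᵀ = -A) : NormedSpace.exp A ∈ SO3 := by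
  have key : ∀ B : Mat3, Bᵀ = -B → (NormedSpace.exp B)ᵀ * NormedSpace.exp B = 1 := by
    intro B hB
    rw [← Matrix.exp_transpose, hB, ← Matrix.exp_add_of_commute _ _ ((Commute.refl B).neg_left)]
    simp
  refine ⟨key A hA, ?_⟩
  have h1 := congrArg Matrix.det (key A hA)
  rw [Matrix.det_mul, Matrix.det_transpose, Matrix.det_one] at h1
  have h2 : NormedSpace.exp A = NormedSpace.exp ((2:ℝ)⁻¹ • A) * NormedSpace.exp ((2:ℝ)⁻¹ • A) := by
    rw [← Matrix.exp_add_of_commute _ _ rfl, ← add_smul]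
    norm_num
  have h3 : 0 ≤ (NormedSpace.exp A).det := by
    rw [h2, Matrix.det_mul]
    exact mul_self_nonneg _
  nlinarith

theorem one_mem_SO3 : (1 : Mat3) ∈ SO3 := by simp [SO3]

theorem mul_mem_SO3 {P Q : Mat3} (hP : P ∈ SO3) (hQ : Q ∈ SO3) : P * Q ∈ SO3 := by
  refine ⟨?_, by rw [Matrix.det_mul, hP.2, hQ.2, one_mul]⟩
  rw [Matrix.transpose_mul, Matrix.mul_assoc, ← Matrix.mul_assoc Pᵀ, hP.1, Matrix.one_mul, hQ.1]

theorem mul_tr {Q : Mat3} (hQ : Q ∈ SO3) : Q * Qᵀ = 1 := mul_eq_one_comm.mp hQ.1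

theorem tr_mem_SO3 {Q : Mat3} (hQ : Q ∈ SO3) : Qᵀ ∈ SO3 :=
  ⟨by rw [Matrix.transpose_transpose, mul_tr hQ], by rw [Matrix.det_transpose, hQ.2]⟩

theorem SO3_mul_GLp {Q F : Mat3} (hQ : Q ∈ SO3) : Q * F ∈ GLp ↔ F ∈ GLp := by
  simp [GLp, Matrix.det_mul, hQ.2]

theorem isOpen_GLp : IsOpen GLp :=
  isOpen_lt continuous_const (Continuous.matrix_det continuous_id)

def leftMul (Q : Mat3) (hQ : Q ∈ SO3) : Mat3 ≃L[ℝ] Mat3 :=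
  LinearEquiv.toContinuousLinearEquiv
    { toFun := fun X => Q * X
      invFun := fun X => Qᵀ * X
      map_add' := fun X Y => Matrix.mul_add Q X Y
      map_smul' := fun c X => Matrix.mul_smul Q c X
      left_inv := fun X => by
        change Qᵀ * (Q * X) = X
        rw [← Matrix.mul_assoc, hQ.1, Matrix.one_mul]
      right_inv := fun X => by
        change Q * (Qᵀ * X) = X
        rw [← Matrix.mul_assoc, mul_tr hQ, Matrix.one_mul] }

theorem leftMul_apply (Q : Mat3) (hQ : Q ∈ SO3) (X : Mat3) : leftMul Q hQ X = Q * X := rfl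

theorem D2_inv {D : Mat3 → Mat3 → ℝ} (hD : IsDissipationDensity D) {F Q : Mat3}
    (hF : F ∈ GLp) (hQ : Q ∈ SO3) (G H : Mat3) :
    D2bil D (Q * F) (Q * F) (Q * G) (Q * H) = D2bil D F F G H := by
  unfold D2bil
  have e : (fun X => (D X F) ^ 2) =ᶠ[𝓝 F] ((fun X => (D X (Q * F)) ^ 2) ∘ leftMul Q hQ) := by
    filter_upwards [isOpen_GLp.mem_nhds hF] with X hX
    simp only [Function.comp, leftMul_apply]
    rw [hD.frame_indiff Q hQ Q hQ X hX F hF]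
  exact hess_equiv (leftMul Q hQ) e G H

theorem D2_skew {D : Mat3 → Mat3 → ℝ} (hD : IsDissipationDensity D) {F : Mat3}
    (hF : F ∈ GLp) (hs : ContDiffAt ℝ 3 (fun X => (D X F) ^ 2) F) (G A : Mat3) (hA : Aᵀ = -A) :
    D2bil D F F (G + A * F) (G + A * F) = D2bil D F F G G := by
  unfold D2bil
  set f : Mat3 → ℝ := fun X => (D X F) ^ 2 with hf
  have hzero : ∀ t : ℝ, fderiv ℝ f (NormedSpace.exp (t • A) * F) = 0 := by
    intro t
    have hE : NormedSpace.exp (t • A) ∈ SO3 :=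
      exp_mem_SO3 _ (by rw [Matrix.transpose_smul, hA, smul_neg])
    apply IsLocalMin.fderiv_eq_zero
    filter_upwards with X
    have : f (NormedSpace.exp (t • A) * F) = 0 := by
      rw [hf]
      simp only
      rw [hD.eq_zero _ ((SO3_mul_GLp hE).2 hF) F hF]
      · norm_num
      · rw [Matrix.transpose_mul, Matrix.mul_assoc, ← Matrix.mul_assoc _ _ F, hE.1, Matrix.one_mul]
    rw [this]
    exact sq_nonneg _
  have hcurve : HasDerivAt (fun t : ℝ => NormedSpace.exp (t • A) * F) (A * F) 0 := by
    let L : Mat3 →L[ℝ] Mat3 := LinearMap.toContinuousLinearMap (LinearMap.mulRight ℝ F)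
    exact L.hasFDerivAt.comp_hasDerivAt 0 (exp_curve A)
  have h0 : NormedSpace.exp ((0:ℝ) • A) * F = F := by
    rw [zero_smul, NormedSpace.exp_zero, Matrix.one_mul]
  have hr := hess_curve (f := f) hcurve (by rw [h0]; exact hs) hzero G
  rw [h0] at hr
  exact hr

/-- There is an `SO(3)`-invariant open neighborhood `U` of `SO(3)` inside
`GL₊(3)` on which `R` satisfies the time-dependent frame indifference
`R(F,Ḟ) = R(QF, Q(Ḟ + AF))` for all `Q ∈ SO(3)` and skew `A`. -/
theorem statement4 (D : Mat3 → Mat3 → ℝ) (hD : IsDissipationDensity D) :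
    ∃ U : Set Mat3, IsOpen U ∧ SO3 ⊆ U ∧ U ⊆ GLp ∧
      (∀ F ∈ U, ∀ Q ∈ SO3, Q * F ∈ U) ∧
      (∀ F ∈ U, ∀ Fdot : Mat3, ∀ Q ∈ SO3, ∀ A : Mat3, Aᵀ = -A →
        Rpot D F Fdot = Rpot D (Q * F) (Q * (Fdot + A * F))) := by
  obtain ⟨V, hVo, hSV, hVG, hVs⟩ := hD.smooth
  have hUG : ∀ F : Mat3, (∃ Q ∈ SO3, (Q * F, Q * F) ∈ V) → F ∈ GLp := by
    rintro F ⟨Q, hQ, h⟩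
    exact (SO3_mul_GLp hQ).1 (hVG h).1
  refine ⟨{F | ∃ Q ∈ SO3, (Q * F, Q * F) ∈ V}, ?_, ?_, hUG, ?_, ?_⟩
  · have : {F : Mat3 | ∃ Q ∈ SO3, (Q * F, Q * F) ∈ V}
        = ⋃ Q ∈ SO3, (fun F : Mat3 => (Q * F, Q * F)) ⁻¹' V := by
      ext F; simp
    rw [this]
    refine isOpen_biUnion fun Q _ => hVo.preimage ?_
    exact (continuous_const.matrix_mul continuous_id).prodMk
      (continuous_const.matrix_mul continuous_id)
  · intro F hF
    refine ⟨1, one_mem_SO3, hSV ?_⟩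
    rw [Matrix.one_mul]
    exact ⟨hF, hF⟩
  · rintro F ⟨P, hP, h⟩ Q hQ
    refine ⟨P * Qᵀ, mul_mem_SO3 hP (tr_mem_SO3 hQ), ?_⟩
    rw [Matrix.mul_assoc, ← Matrix.mul_assoc _ Q F, hQ.1, Matrix.one_mul]
    exact h
  · intro F hF Fdot Q hQ A hA
    have hFG := hUG F hF
    obtain ⟨P, hP, h⟩ := hF
    have hs : ContDiffAt ℝ 3 (fun X => (D X F) ^ 2) F := by
      have h1 : ContDiffAt ℝ 3 (fun p : Mat3 × Mat3 => (D p.1 p.2) ^ 2) (P * F, P * F) :=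
        hVs.contDiffAt (hVo.mem_nhds h)
      have h2 : ContDiffAt ℝ 3 (fun X : Mat3 => (leftMul P hP X, P * F)) F :=
        (leftMul P hP).contDiff.contDiffAt.prodMk contDiffAt_const
      have h3 := ContDiffAt.comp F (g := fun p : Mat3 × Mat3 => (D p.1 p.2) ^ 2) h1 h2
      refine h3.congr_of_eventuallyEq ?_
      filter_upwards [isOpen_GLp.mem_nhds hFG] with X hX
      simp only [Function.comp, leftMul_apply]
      rw [hD.frame_indiff P hP P hP X hX F hFG]
    unfold Rpot
    rw [D2_inv hD hFG hQ, D2_skew hD hFG hs Fdot A hA]
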